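/- Let F : [0,∞) × ℝ → ℝ be continuous. Then there exist a real e > 0 and a solution y_m of (*) defined on [0,e] such that every solution y of (*) defined on [0,a) satisfies y(x) ≤ y_m(x) for all x ∈ [0, min{e, a}). -/

import Mathlib

/-- `y` is a solution of the initial value problem (*): `y 0 = 0`, `y' x = F (x, y x)`,
on the interval `[0, a)` where `0 < a ≤ ∞` (one-sided derivative at `0`). -/
def IsSolutionOn (F : ℝ × ℝ → ℝ) (a : EReal) (y : ℝ → ℝ) : Prop :=
  0 < a ∧ y 0 = 0 ∧
    ∀ x : ℝ, 0 ≤ x → (x : EReal) < a →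
      HasDerivWithinAt y (F (x, y x)) {t : ℝ | 0 ≤ t ∧ (t : EReal) < a} x

/-- A solution of (*) on `[0, a)` is global (noncontinuable) if it is not the
restriction of a solution on any `[0, a')` with `a' > a`. -/
def IsGlobalSolutionOn (F : ℝ × ℝ → ℝ) (a : EReal) (y : ℝ → ℝ) : Prop :=
  IsSolutionOn F a y ∧
    ¬ ∃ (a' : EReal) (z : ℝ → ℝ), a < a' ∧ IsSolutionOn F a' z ∧
        ∀ x : ℝ, 0 ≤ x → (x : EReal) < a → z x = y x

open Set Filter Topology MeasureTheory
open scoped NNReal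

/-- A bounded uniformly continuous function of two real variables is uniformly approximated by
continuous functions that are Lipschitz in the second variable. -/
theorem exists_lipschitz_snd_approx {H : ℝ × ℝ → ℝ} (hH : UniformContinuous H) {M : ℝ≥0}
    (hM : ∀ p, |H p| ≤ M) {ε : ℝ} (hε : 0 < ε) :
    ∃ (L : ℝ × ℝ → ℝ) (K : ℝ≥0), Continuous L ∧ (∀ t, LipschitzWith K fun y ↦ L (t, y)) ∧
      ∀ p, |L p - H p| ≤ ε := by
  obtain ⟨δ, hδ, hHδ⟩ := Metric.uniformContinuous_iff.1 hH ε hε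
  have hc : Continuous H := hH.continuous
  have hη : 0 < δ / 2 := by positivity
  set η : ℝ := δ / 2
  refine ⟨fun p ↦ η⁻¹ * ∫ s in (0 : ℝ)..η, H (p.1, p.2 + s),
    Real.toNNReal (η⁻¹ * (2 * M)), ?_, fun t ↦ ?_, fun p ↦ ?_⟩
  · refine continuous_const.mul
      (intervalIntegral.continuous_parametric_intervalIntegral_of_continuous' ?_ 0 η)
    unfold Function.uncurry
    fun_prop
  · refine LipschitzWith.of_dist_le_mul fun y z ↦ ?_
    rw [Real.coe_toNNReal _ (by positivity), Real.dist_eq, Real.dist_eq, ← mul_sub, abs_mul,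
      abs_of_pos (inv_pos.2 hη), mul_assoc]
    refine mul_le_mul_of_nonneg_left ?_ (inv_pos.2 hη).le
    have hi : ∀ a b, IntervalIntegrable (fun s ↦ H (t, s)) volume a b := fun a b ↦
      (show Continuous fun s ↦ H (t, s) by fun_prop).intervalIntegrable a b
    have hb : ∀ a b, |∫ s in a..b, H (t, s)| ≤ M * |b - a| := fun a b ↦ by
      rw [← Real.norm_eq_abs]
      exact intervalIntegral.norm_integral_le_of_norm_le_const fun s _ ↦ hM (t, s)
    simp only [intervalIntegral.integral_comp_add_left (fun s ↦ H (t, s))]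
    rw [intervalIntegral.integral_interval_sub_interval_comm (hi _ _) (hi _ _) (hi _ _)]
    refine (abs_sub _ _).trans ?_
    have h1 := hb (y + 0) (z + 0)
    have h2 := hb (y + η) (z + η)
    rw [add_sub_add_right_eq_sub, abs_sub_comm] at h1 h2
    linarith
  · have hi : IntervalIntegrable (fun s ↦ H (p.1, p.2 + s)) volume 0 η :=
      (show Continuous fun s ↦ H (p.1, p.2 + s) by fun_prop).intervalIntegrable _ _
    have h : η⁻¹ * (∫ s in (0 : ℝ)..η, H (p.1, p.2 + s)) - H p
        = η⁻¹ * ∫ s in (0 : ℝ)..η, (H (p.1, p.2 + s) - H p) := by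
      rw [intervalIntegral.integral_sub hi (by simp), intervalIntegral.integral_const]
      simp
      field_simp
    have hb : |∫ s in (0 : ℝ)..η, (H (p.1, p.2 + s) - H p)| ≤ ε * |η - 0| := by
      rw [← Real.norm_eq_abs]
      refine intervalIntegral.norm_integral_le_of_norm_le_const fun s hs ↦ ?_
      rw [uIoc_of_le hη.le] at hs
      refine (hHδ ?_).le
      have : |s| < δ := by
        rw [abs_of_pos hs.1]
        exact hs.2.trans_lt (half_lt_self hδ)
      rw [Prod.dist_eq]
      simpa [Real.dist_eq, hδ] using this
    rw [h, abs_mul, abs_of_pos (inv_pos.2 hη), inv_mul_le_iff₀ hη]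
    rw [sub_zero, abs_of_pos hη] at hb
    linarith

/-- Global form of the Picard-Lindelöf theorem on `[0, e]` for a bounded continuous right-hand
side that is Lipschitz in the second variable. -/
theorem exists_lipschitz_solution {L : ℝ × ℝ → ℝ} (hL : Continuous L) {K C : ℝ≥0}
    (hK : ∀ t, LipschitzWith K fun y ↦ L (t, y)) (hC : ∀ p, |L p| ≤ C) {e : ℝ} (he : 0 ≤ e) :
    ∃ y : ℝ → ℝ, LipschitzWith C y ∧ y 0 = 0 ∧ (∀ t, y (projIcc 0 e he t) = y t) ∧
      ∀ t ∈ Icc 0 e, HasDerivWithinAt y (L (t, y t)) (Icc 0 e) t := by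
  have hCe : (0 : ℝ) ≤ C * e := mul_nonneg C.2 he
  have hPL : IsPicardLindelof (fun t y ↦ L (t, y)) (⟨0, by simp [he]⟩ : Icc (0 : ℝ) e) 0
      (C * e).toNNReal 0 C K :=
    { lipschitzOnWith := fun t _ ↦ (hK t).lipschitzOnWith
      continuousOn := fun x _ ↦ (show Continuous fun t ↦ L (t, x) by fun_prop).continuousOn
      norm_le := fun t _ x _ ↦ hC (t, x)
      mul_max_le := by simp [he, Real.coe_toNNReal _ hCe] }
  obtain ⟨z, hz0, hz⟩ := hPL.exists_eq_forall_mem_Icc_hasDerivWithinAt₀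
  have hzL : LipschitzOnWith C z (Icc 0 e) :=
    (convex_Icc _ _).lipschitzOnWith_of_nnnorm_hasDerivWithin_le hz fun t _ ↦ hC _
  have heq : ∀ t ∈ Icc (0 : ℝ) e, IccExtend he ((Icc (0 : ℝ) e).domRestrict z) t = z t := by
    intro t ht
    rw [IccExtend_of_mem _ _ ht, domRestrict_apply]
  refine ⟨IccExtend he ((Icc (0 : ℝ) e).domRestrict z), ?_, ?_,
    fun t ↦ by rw [IccExtend_val, IccExtend, Function.comp_apply], fun t ht ↦ ?_⟩
  · have := hzL.to_restrict.comp (LipschitzWith.projIcc he)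
    rwa [mul_one] at this
  · rw [heq 0 (by simp [he])]
    exact hz0
  · rw [heq t ht]
    exact (hz t ht).congr heq (heq t ht)

/-- Comparison of a solution of `u' = f` with a strict supersolution. -/
theorem le_of_hasDerivWithinAt_of_lt {u v u' v' : ℝ → ℝ} {b : ℝ} (h0 : u 0 ≤ v 0)
    (hu : ∀ t ∈ Icc 0 b, HasDerivWithinAt u (u' t) (Icc 0 b) t)
    (hv : ∀ t ∈ Icc 0 b, HasDerivWithinAt v (v' t) (Icc 0 b) t)
    (h : ∀ t ∈ Ico 0 b, u t = v t → u' t < v' t) {t : ℝ} (ht : t ∈ Icc 0 b) : u t ≤ v t := by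
  have key : ∀ {w w' : ℝ → ℝ}, (∀ t ∈ Icc 0 b, HasDerivWithinAt w (w' t) (Icc 0 b) t) →
      ∀ t ∈ Ico 0 b, HasDerivWithinAt w (w' t) (Ici t) t := fun hw t ht ↦
    (hw t (Ico_subset_Icc_self ht)).mono_of_mem_nhdsWithin (Icc_mem_nhdsGE_of_mem ht)
  exact image_le_of_deriv_right_lt_deriv_boundary' (fun t ht ↦ (hu t ht).continuousWithinAt)
    (key hu) h0 (fun t ht ↦ (hv t ht).continuousWithinAt) (key hv) h ht

/-- A pointwise limit of uniformly Lipschitz solutions of equations whose bounded right-hand sides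
converge uniformly is a solution of the limit equation. -/
theorem hasDerivWithinAt_of_tendsto_solutions {H : ℝ × ℝ → ℝ} (hH : Continuous H)
    {L : ℕ → ℝ × ℝ → ℝ} (hL : ∀ n, Continuous (L n)) {C : ℝ≥0} (hC : ∀ n p, |L n p| ≤ C)
    (hLH : TendstoUniformly L H atTop) {e : ℝ} {y : ℕ → ℝ → ℝ} {z : ℝ → ℝ}
    (hyC : ∀ n, LipschitzWith C (y n)) (hy0 : ∀ n, y n 0 = 0)
    (hy : ∀ n, ∀ t ∈ Icc 0 e, HasDerivWithinAt (y n) (L n (t, y n t)) (Icc 0 e) t)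
    (hyz : ∀ t, Tendsto (fun n ↦ y n t) atTop (𝓝 (z t))) {x : ℝ} (hx : x ∈ Icc 0 e) :
    HasDerivWithinAt z (H (x, z x)) (Icc 0 e) x := by
  have hz : Continuous z := by
    refine (LipschitzWith.of_dist_le_mul (K := C) fun s t ↦ ?_).continuous
    exact le_of_tendsto' ((hyz s).dist (hyz t)) fun n ↦ (hyC n).dist_le_mul s t
  have hyc : ∀ n, Continuous (y n) := fun n ↦ (hyC n).continuous
  have hg : Continuous fun s ↦ H (s, z s) := by fun_prop
  have hLc : ∀ n, Continuous fun s ↦ L n (s, y n s) := fun n ↦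
    (hL n).comp (continuous_id.prodMk (hyc n))
  have hint : ∀ t ∈ Icc 0 e, z t = ∫ s in (0 : ℝ)..t, H (s, z s) := by
    intro t ht
    have hn : ∀ n, ∫ s in (0 : ℝ)..t, L n (s, y n s) = y n t := by
      intro n
      rw [intervalIntegral.integral_eq_sub_of_hasDeriv_right_of_le ht.1 (hyc n).continuousOn
        (fun s hs ↦ ?_) ((hLc n).intervalIntegrable _ _), hy0, sub_zero]
      have hs' : s ∈ Ico 0 e := ⟨hs.1.le, hs.2.trans_le ht.2⟩
      exact (hy n s (Ico_subset_Icc_self hs')).mono_of_mem_nhdsWithin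
        (nhdsWithin_mono _ Ioi_subset_Ici_self (Icc_mem_nhdsGE_of_mem hs'))
    refine tendsto_nhds_unique (hyz t) ?_
    simp_rw [← hn]
    refine intervalIntegral.tendsto_integral_filter_of_dominated_convergence (fun _ ↦ (C : ℝ))
      (.of_forall fun n ↦ (hLc n).aestronglyMeasurable)
      (.of_forall fun n ↦ .of_forall fun s _ ↦ hC n _)
      (by simp) (.of_forall fun s _ ↦ ?_)
    exact hLH.tendsto_comp hH.continuousAt (tendsto_const_nhds.prodMk_nhds (hyz s))
  exact (hg.integral_hasStrictDerivAt 0 x).hasDerivAt.hasDerivWithinAt.congr hint (hint x hx)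

/-- A bounded uniformly continuous function is the uniform limit of a strictly decreasing sequence
of continuous functions that are Lipschitz in the second variable. -/
theorem exists_lipschitz_snd_strictAnti {H : ℝ × ℝ → ℝ} (hH : UniformContinuous H) {M : ℝ≥0}
    (hM : ∀ p, |H p| ≤ M) :
    ∃ L : ℕ → ℝ × ℝ → ℝ, (∀ n, Continuous (L n)) ∧
      (∀ n, ∃ K : ℝ≥0, ∀ t, LipschitzWith K fun y ↦ L n (t, y)) ∧ (∀ n p, H p < L n p) ∧
      (∀ n p, L (n + 1) p < L n p) ∧ (∀ n p, |L n p| ≤ (M + 2 : ℝ≥0)) ∧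
      TendstoUniformly L H atTop := by
  have hpos : ∀ n : ℕ, (0 : ℝ) < (1 / 2) ^ n / 4 := fun n ↦ by positivity
  choose L K hLc hLK hLH using fun n ↦ exists_lipschitz_snd_approx hH hM (hpos n)
  have hlow : ∀ n p, H p + 3 / 4 * (1 / 2) ^ n ≤ L n p + (1 / 2) ^ n := fun n p ↦ by
    have := (abs_le.1 (hLH n p)).1
    linarith
  have hup : ∀ n p, L n p + (1 / 2) ^ n ≤ H p + 5 / 4 * (1 / 2) ^ n := fun n p ↦ by
    have := (abs_le.1 (hLH n p)).2
    linarith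
  have hle : ∀ n : ℕ, ((1 : ℝ) / 2) ^ n ≤ 1 := fun n ↦ pow_le_one₀ (by norm_num) (by norm_num)
  refine ⟨fun n p ↦ L n p + (1 / 2) ^ n, fun n ↦ (hLc n).add continuous_const,
    fun n ↦ ⟨K n, fun t ↦ ?_⟩, fun n p ↦ ?_, fun n p ↦ ?_, fun n p ↦ ?_, ?_⟩
  · simpa using (hLK n t).add (LipschitzWith.const ((1 / 2 : ℝ) ^ n))
  · linarith [hlow n p, hpos n]
  · have h := hup (n + 1) p
    refine h.trans_lt ?_
    rw [pow_succ]
    linarith [hlow n p, hpos n]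
  · have h := abs_le.1 (hM p)
    push_cast
    rw [abs_le]
    constructor <;> linarith [hlow n p, hup n p, hle n, hpos n]
  · rw [Metric.tendstoUniformly_iff]
    intro ε hε
    have h0 : Tendsto (fun n : ℕ ↦ 5 / 4 * ((1 : ℝ) / 2) ^ n) atTop (𝓝 (5 / 4 * 0)) :=
      (tendsto_pow_atTop_nhds_zero_of_lt_one (by norm_num) (by norm_num)).const_mul _
    rw [mul_zero] at h0
    filter_upwards [h0.eventually_lt_const hε] with n hn p
    rw [Real.dist_eq, abs_lt]
    constructor <;> linarith [hlow n p, hup n p, hpos n]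

/-- A function that is continuous on `[0, ∞) × ℝ` agrees on `[0, 1] × [-1, 1]` with a bounded
uniformly continuous function on the plane. -/
theorem exists_uniformContinuous_eqOn {F : ℝ × ℝ → ℝ}
    (hF : ContinuousOn F (Ici (0 : ℝ) ×ˢ (univ : Set ℝ))) :
    ∃ (H : ℝ × ℝ → ℝ) (M : ℝ≥0), UniformContinuous H ∧ (∀ p, |H p| ≤ M) ∧
      EqOn H F (Icc 0 1 ×ˢ Icc (-1) 1) := by
  have h2 : (-1 : ℝ) ≤ 1 := by norm_num
  let G : Icc (0 : ℝ) 1 × Icc (-1 : ℝ) 1 → ℝ := fun q ↦ F (q.1, q.2)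
  have hG : Continuous G := hF.comp_continuous (by fun_prop) fun q ↦ ⟨q.1.2.1, mem_univ _⟩
  obtain ⟨M, hM⟩ := isCompact_univ.exists_bound_of_continuousOn hG.continuousOn
  refine ⟨fun p ↦ G (projIcc 0 1 zero_le_one p.1, projIcc (-1) 1 h2 p.2), M.toNNReal, ?_,
    fun p ↦ (hM _ (mem_univ _)).trans (Real.le_coe_toNNReal M), fun p hp ↦ ?_⟩
  · exact (CompactSpace.uniformContinuous_of_continuous hG).comp
      (((LipschitzWith.projIcc _).uniformContinuous.comp uniformContinuous_fst).prodMk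
        ((LipschitzWith.projIcc _).uniformContinuous.comp uniformContinuous_snd))
  · simp only [G, projIcc_of_mem _ hp.1, projIcc_of_mem _ hp.2]

/-- **Existence of a local maximal solution** (context of Lemma 6.5).
Let `F : [0,∞) × ℝ → ℝ` be continuous. There exist `e > 0` and a solution `ym` of (*)
on `[0, e]` that dominates every solution `y` of (*) on `[0, a)` pointwise on
`[0, min {e, a})`. -/
theorem local_maximal_solution_exists (F : ℝ × ℝ → ℝ)
    (hF : ContinuousOn F (Set.Ici (0 : ℝ) ×ˢ (Set.univ : Set ℝ))) :
    ∃ (e : ℝ) (ym : ℝ → ℝ), 0 < e ∧ ym 0 = 0 ∧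
      (∀ x ∈ Set.Icc (0 : ℝ) e,
        HasDerivWithinAt ym (F (x, ym x)) (Set.Icc (0 : ℝ) e) x) ∧
      ∀ (a : EReal) (y : ℝ → ℝ), IsSolutionOn F a y →
        ∀ x : ℝ, 0 ≤ x → x < e → (x : EReal) < a → y x ≤ ym x := by
  obtain ⟨H, M, hHu, hHM, hHF⟩ := exists_uniformContinuous_eqOn hF
  obtain ⟨L, hLc, hLK, hHL, hLL, hLM, hLH⟩ := exists_lipschitz_snd_strictAnti hHu hHM
  set C : ℝ≥0 := M + 2 with hC
  have hC2 : (2 : ℝ) ≤ C := by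
    rw [hC]
    push_cast
    linarith [M.2]
  have he : (0 : ℝ) < (C : ℝ)⁻¹ := by positivity
  have he1 : (C : ℝ)⁻¹ ≤ 1 := inv_le_one_of_one_le₀ (by linarith)
  have hCe : (C : ℝ) * (C : ℝ)⁻¹ = 1 := mul_inv_cancel₀ (by positivity)
  set e : ℝ := (C : ℝ)⁻¹
  choose K hK using hLK
  choose y hyC hy0 hyp hy using fun n ↦ exists_lipschitz_solution (hLc n) (hK n) (hLM n) he.le
  have hyb : ∀ n, ∀ t ∈ Icc 0 e, y n t ∈ Icc (-1) 1 := by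
    intro n t ht
    have h := (hyC n).dist_le_mul t 0
    rw [hy0, Real.dist_eq, Real.dist_eq, sub_zero, sub_zero, abs_of_nonneg ht.1] at h
    exact abs_le.1 (h.trans ((mul_le_mul_of_nonneg_left ht.2 C.2).trans hCe.le))
  have hmono : ∀ t ∈ Icc 0 e, Antitone fun n ↦ y n t := fun t ht ↦
    antitone_nat_of_succ_le fun n ↦
      le_of_hasDerivWithinAt_of_lt (by rw [hy0, hy0]) (hy (n + 1)) (hy n)
        (fun s _ hs ↦ by rw [hs]; exact hLL n _) ht
  let z : ℝ → ℝ := fun t ↦ ⨅ n, y n t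
  have hyz : ∀ t, Tendsto (fun n ↦ y n t) atTop (𝓝 (z t)) := by
    intro t
    have ht := (projIcc 0 e he.le t).2
    have hm := hmono _ ht
    have hb : BddBelow (range fun n ↦ y n t) := by
      refine ⟨-1, forall_mem_range.2 fun n ↦ ?_⟩
      rw [← hyp n t]
      exact (hyb n _ ht).1
    simp only [hyp] at hm
    exact tendsto_atTop_ciInf hm hb
  have hzF : ∀ t ∈ Icc 0 e, H (t, z t) = F (t, z t) := fun t ht ↦
    hHF ⟨⟨ht.1, ht.2.trans he1⟩,
      isClosed_Icc.mem_of_tendsto (hyz t) (.of_forall fun n ↦ hyb n t ht)⟩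
  refine ⟨e, z, he, by simp [z, hy0], fun x hx ↦ ?_, fun a u hu x hx0 hxe hxa ↦ ?_⟩
  · rw [← hzF x hx]
    exact hasDerivWithinAt_of_tendsto_solutions hHu.continuous hLc hLM hLH hyC hy0 hy hyz hx
  · obtain ⟨-, hu0, hu⟩ := hu
    have hsub : Icc 0 x ⊆ {t : ℝ | 0 ≤ t ∧ (t : EReal) < a} := fun t ht ↦
      ⟨ht.1, (EReal.coe_le_coe_iff.2 ht.2).trans_lt hxa⟩
    have hsub' : Icc 0 x ⊆ Icc 0 e := Icc_subset_Icc_right hxe.le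
    refine ge_of_tendsto' (hyz x) fun n ↦ le_of_hasDerivWithinAt_of_lt (by rw [hu0, hy0])
      (fun t ht ↦ (hu t (hsub ht).1 (hsub ht).2).mono hsub)
      (fun t ht ↦ (hy n t (hsub' ht)).mono hsub') (fun t ht hut ↦ ?_) ⟨hx0, le_rfl⟩
    have hte : t ∈ Icc 0 e := hsub' (Ico_subset_Icc_self ht)
    rw [hut, ← hHF ⟨⟨hte.1, hte.2.trans he1⟩, hyb n t hte⟩]
    exact hHL n _
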